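/- arXiv:0901.4314 — 6 statements merged into one kernel-verified Lean document; each statement's English description precedes it below -/
import Mathlib

section
/- Let I ⊆ ℝ be an open interval and let θ ∈ C⁴(I) satisfy θ(x) > 0 and (1/2)·θ(x) = θ(x)²·(−θ⁗(x) + θ(x)) for all x ∈ I. Then the function x ↦ (1/2)·ln θ(x) + θ′(x)·θ‴(x) − (1/2)·(θ″(x))² − (1/2)·θ(x)² is constant on I. -/
/-- On an open set, an iterated derivative within the set of order `k < n` of a `C^n` function
has the next one as its derivative. -/
theorem ContDiffOn.hasDerivAt_iteratedDerivWithin {f : ℝ → ℝ} {s : Set ℝ} {n : WithTop ℕ∞}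
    {k : ℕ} {x : ℝ} (hf : ContDiffOn ℝ n f s) (hs : IsOpen s) (hk : (k : WithTop ℕ∞) < n)
    (hx : x ∈ s) :
    HasDerivAt (iteratedDerivWithin k f s) (iteratedDerivWithin (k + 1) f s x) x := by
  rw [iteratedDerivWithin_succ]
  exact (hf.differentiableOn_iteratedDerivWithin hk hs.uniqueDiffOn x hx).hasDerivWithinAt
    |>.hasDerivAt (hs.mem_nhds hx)

/-- First-integral identity for the fourth-order blow-up profile ODE
`(1/2)θ = θ²(−θ⁗ + θ)`: on any open interval `I` where `θ ∈ C⁴` is positive and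
satisfies the ODE, the quantity
`(1/2)·ln θ + θ′·θ‴ − (1/2)(θ″)² − (1/2)θ²` is constant. -/
theorem fourth_order_profile_first_integral
    (I : Set ℝ) (hIopen : IsOpen I) (hIconn : I.OrdConnected)
    (θ : ℝ → ℝ) (hθ : ContDiffOn ℝ 4 θ I)
    (hpos : ∀ x ∈ I, 0 < θ x)
    (hode : ∀ x ∈ I,
      (1/2 : ℝ) * θ x = (θ x)^2 * (-(iteratedDerivWithin 4 θ I x) + θ x)) :
    ∃ c : ℝ, ∀ x ∈ I,
      (1/2 : ℝ) * Real.log (θ x)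
        + derivWithin θ I x * iteratedDerivWithin 3 θ I x
        - (1/2 : ℝ) * (iteratedDerivWithin 2 θ I x)^2
        - (1/2 : ℝ) * (θ x)^2 = c := by
  have hderiv : ∀ x ∈ I, HasDerivAt (fun x => (1/2 : ℝ) * Real.log (θ x)
      + derivWithin θ I x * iteratedDerivWithin 3 θ I x
      - (1/2 : ℝ) * (iteratedDerivWithin 2 θ I x)^2 - (1/2 : ℝ) * (θ x)^2) 0 x := by
    intro x hx
    have h0 : HasDerivAt θ (derivWithin θ I x) x := by
      simpa [iteratedDerivWithin_one, iteratedDerivWithin_zero] using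
        hθ.hasDerivAt_iteratedDerivWithin (k := 0) hIopen (by norm_num) hx
    have h1 : HasDerivAt (derivWithin θ I) (iteratedDerivWithin 2 θ I x) x := by
      have h := hθ.hasDerivAt_iteratedDerivWithin (k := 1) hIopen (by norm_num) hx
      rwa [iteratedDerivWithin_one] at h
    have h2 := hθ.hasDerivAt_iteratedDerivWithin (k := 2) hIopen (by norm_num) hx
    have h3 := hθ.hasDerivAt_iteratedDerivWithin (k := 3) hIopen (by norm_num) hx
    have hne : θ x ≠ 0 := (hpos x hx).ne'
    have hquot : 1 / (2 * θ x) = -(iteratedDerivWithin 4 θ I x) + θ x := by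
      rw [div_eq_iff (by positivity)]
      apply mul_left_cancel₀ hne
      linear_combination 2 * hode x hx
    refine (((((h0.log hne).const_mul (1/2 : ℝ)).add (h1.mul h3)).sub
      ((h2.pow 2).const_mul (1/2 : ℝ))).sub ((h0.pow 2).const_mul (1/2 : ℝ))).congr_deriv ?_
    have hlog : (1/2 : ℝ) * (derivWithin θ I x / θ x) = derivWithin θ I x * (1 / (2 * θ x)) := by
      field_simp
    rw [hlog, hquot]
    norm_num
    ring
  exact hIopen.exists_is_const_of_deriv_eq_zero hIconn.isPreconnected
    (fun x hx => (hderiv x hx).differentiableAt.differentiableWithinAt)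
    (fun x hx => (hderiv x hx).deriv)
end

section
/- Let L > 0 and let v : ℝ × [0,∞) → ℝ be a smooth function, 2L-periodic in the first (space) variable x, with v(x,τ) > 0 everywhere, satisfying the rescaled equation v_τ = v²·(−v_xxxx + v) − (1/2)·v. Then the function E(τ) = ∫₀^{2L} [ (1/2)·(v_xx(x,τ))² − (1/2)·v(x,τ)² + (1/2)·ln v(x,τ) ] dx is differentiable and satisfies E′(τ) = − ∫₀^{2L} (v_τ(x,τ))² / v(x,τ)² dx ≤ 0 for all τ ≥ 0; in particular E is non-increasing. -/
open MeasureTheory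

/-- The Lyapunov functional for the rescaled fourth-order flow
`v_τ = v²(−v_xxxx + v) − (1/2)v` with `2L`-periodic boundary conditions. -/
noncomputable def rescaledEnergy (L : ℝ) (v : ℝ → ℝ → ℝ) (τ : ℝ) : ℝ :=
  ∫ x in (0:ℝ)..(2*L),
    ((1/2 : ℝ) * (iteratedDeriv 2 (fun y => v y τ) x)^2
      - (1/2 : ℝ) * (v x τ)^2 + (1/2 : ℝ) * Real.log (v x τ))

open Set

/-- The closed half-plane `ℝ × [0, ∞)` on which the flow lives. -/
abbrev closedHalfPlane : Set (ℝ × ℝ) := univ ×ˢ Ici (0 : ℝ)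

/-- The derivative along `e` of a function on the closed half-plane, one-sided at the boundary. -/
noncomputable def halfPlaneDeriv (e : ℝ × ℝ) (f : ℝ × ℝ → ℝ) (p : ℝ × ℝ) : ℝ :=
  fderivWithin ℝ f closedHalfPlane p e

lemma uniqueDiffOn_closedHalfPlane : UniqueDiffOn ℝ closedHalfPlane :=
  uniqueDiffOn_univ.prod (uniqueDiffOn_Ici 0)

lemma mk_mem_closedHalfPlane (x : ℝ) {τ : ℝ} (hτ : 0 ≤ τ) : (x, τ) ∈ closedHalfPlane :=
  ⟨mem_univ _, hτ⟩

section HalfPlane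

variable {f g : ℝ × ℝ → ℝ}

lemma ContDiffOn.halfPlaneDeriv (hf : ContDiffOn ℝ (⊤ : ℕ∞) f closedHalfPlane) (e : ℝ × ℝ) :
    ContDiffOn ℝ (⊤ : ℕ∞) (halfPlaneDeriv e f) closedHalfPlane :=
  (hf.fderivWithin uniqueDiffOn_closedHalfPlane (by simp)).clm_apply contDiffOn_const

lemma halfPlaneDeriv_congr (h : EqOn f g closedHalfPlane) (e : ℝ × ℝ) :
    EqOn (halfPlaneDeriv e f) (halfPlaneDeriv e g) closedHalfPlane := fun _ hp ↦ by
  rw [halfPlaneDeriv, halfPlaneDeriv, fderivWithin_congr' h hp]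

/-- Mixed partial derivatives commute up to the boundary of the half-plane. -/
lemma halfPlaneDeriv_comm (hf : ContDiffOn ℝ (⊤ : ℕ∞) f closedHalfPlane) (e e' : ℝ × ℝ) :
    EqOn (halfPlaneDeriv e (halfPlaneDeriv e' f)) (halfPlaneDeriv e' (halfPlaneDeriv e f))
      closedHalfPlane := by
  intro p hp
  have hd : DifferentiableWithinAt ℝ (fderivWithin ℝ f closedHalfPlane) closedHalfPlane p :=
    (hf.fderivWithin (m := 1) uniqueDiffOn_closedHalfPlane (by norm_cast)
      ).differentiableOn one_ne_zero p hp
  have key (a b : ℝ × ℝ) : halfPlaneDeriv a (halfPlaneDeriv b f) p =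
      fderivWithin ℝ (fderivWithin ℝ f closedHalfPlane) closedHalfPlane p a b := by
    unfold halfPlaneDeriv
    rw [fderivWithin_clm_apply (uniqueDiffOn_closedHalfPlane p hp) hd
      (differentiableWithinAt_const b)]
    simp
  rw [key, key]
  refine (hf p hp).isSymmSndFDerivWithinAt ?_ uniqueDiffOn_closedHalfPlane ?_ hp e e'
  · simp only [minSmoothness_of_isRCLikeNormedField]
    norm_cast
  · rw [interior_prod_eq, closure_prod_eq]
    simpa using hp

lemma hasDerivAt_halfPlane_fst (hf : ContDiffOn ℝ (⊤ : ℕ∞) f closedHalfPlane) (x : ℝ) {τ : ℝ}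
    (hτ : 0 ≤ τ) : HasDerivAt (fun y ↦ f (y, τ)) (halfPlaneDeriv (1, 0) f (x, τ)) x := by
  have hd := (hf.differentiableOn (by simp) _ (mk_mem_closedHalfPlane x hτ)).hasFDerivWithinAt
  have hc : HasDerivWithinAt (fun y : ℝ ↦ (y, τ)) (1, 0) univ x :=
    ((hasDerivAt_id x).prodMk (hasDerivAt_const x τ)).hasDerivWithinAt
  exact hasDerivWithinAt_univ.1
    (hd.comp_hasDerivWithinAt x hc fun y _ ↦ mk_mem_closedHalfPlane y hτ)

lemma hasDerivWithinAt_halfPlane_snd (hf : ContDiffOn ℝ (⊤ : ℕ∞) f closedHalfPlane) (x : ℝ)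
    {τ : ℝ} (hτ : 0 ≤ τ) :
    HasDerivWithinAt (fun s ↦ f (x, s)) (halfPlaneDeriv (0, 1) f (x, τ)) (Ici 0) τ := by
  have hd := (hf.differentiableOn (by simp) _ (mk_mem_closedHalfPlane x hτ)).hasFDerivWithinAt
  have hc : HasDerivWithinAt (fun s : ℝ ↦ (x, s)) (0, 1) (Ici 0) τ :=
    ((hasDerivAt_const τ x).prodMk (hasDerivAt_id τ)).hasDerivWithinAt
  exact hd.comp_hasDerivWithinAt τ hc fun s hs ↦ mk_mem_closedHalfPlane x hs

lemma ContDiffOn.iterate_halfPlaneDeriv (hf : ContDiffOn ℝ (⊤ : ℕ∞) f closedHalfPlane)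
    (e : ℝ × ℝ) (n : ℕ) :
    ContDiffOn ℝ (⊤ : ℕ∞) ((_root_.halfPlaneDeriv e)^[n] f) closedHalfPlane := by
  induction n with
  | zero => exact hf
  | succ n ih => rw [Function.iterate_succ_apply']; exact ih.halfPlaneDeriv e

lemma iteratedDeriv_halfPlane_fst (hf : ContDiffOn ℝ (⊤ : ℕ∞) f closedHalfPlane) {τ : ℝ}
    (hτ : 0 ≤ τ) (n : ℕ) :
    iteratedDeriv n (fun y ↦ f (y, τ)) = fun x ↦ (halfPlaneDeriv (1, 0))^[n] f (x, τ) := by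
  induction n with
  | zero => simp
  | succ n ih =>
    rw [iteratedDeriv_succ, ih]
    ext x
    rw [Function.iterate_succ_apply']
    exact (hasDerivAt_halfPlane_fst (hf.iterate_halfPlaneDeriv (1, 0) n) x hτ).deriv

/-- Derivatives of a function that is periodic in the first variable are periodic. -/
lemma halfPlaneDeriv_periodic {c : ℝ} (hf : ContDiffOn ℝ (⊤ : ℕ∞) f closedHalfPlane)
    (hper : ∀ x τ, 0 ≤ τ → f (x + c, τ) = f (x, τ)) (e : ℝ × ℝ) (x τ : ℝ) (hτ : 0 ≤ τ) :
    halfPlaneDeriv e f (x + c, τ) = halfPlaneDeriv e f (x, τ) := by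
  have hmaps : MapsTo (fun p : ℝ × ℝ ↦ p + (c, 0)) closedHalfPlane closedHalfPlane :=
    fun p hp ↦ ⟨mem_univ _, by simpa using hp.2⟩
  have hp := mk_mem_closedHalfPlane x hτ
  have hq := (hf.differentiableOn (by simp) _ (hmaps hp)).hasFDerivWithinAt
  have hcomp := hq.comp (x, τ) ((hasFDerivWithinAt_id (𝕜 := ℝ) _ _).add_const (c, 0)) hmaps
  have heq : fderivWithin ℝ f closedHalfPlane (x, τ) =
      fderivWithin ℝ f closedHalfPlane ((x, τ) + (c, 0)) := by
    refine HasFDerivWithinAt.fderivWithin ?_ (uniqueDiffOn_closedHalfPlane _ hp)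
    refine (hcomp.congr (fun p hp ↦ ?_) ?_).congr_fderiv (ContinuousLinearMap.comp_id _)
    · have hshift : p + (c, 0) = (p.1 + c, p.2) := by ext <;> simp
      simpa [hshift] using (hper p.1 p.2 hp.2).symm
    · simpa using (hper x τ hτ).symm
  simp only [halfPlaneDeriv, heq, Prod.mk_add_mk, add_zero]

lemma continuous_halfPlane_fst (hf : ContinuousOn f closedHalfPlane) {τ : ℝ} (hτ : 0 ≤ τ) :
    Continuous fun x ↦ f (x, τ) :=
  hf.comp_continuous (by fun_prop) fun x ↦ mk_mem_closedHalfPlane x hτ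

/-- Differentiation under the integral sign, one-sided at the boundary of the half-plane. -/
lemma hasDerivWithinAt_integral_halfPlane {f' : ℝ × ℝ → ℝ} (hf : ContinuousOn f closedHalfPlane)
    (hf' : ContinuousOn f' closedHalfPlane)
    (hderiv : ∀ x τ, 0 ≤ τ → HasDerivWithinAt (fun s ↦ f (x, s)) (f' (x, τ)) (Ici 0) τ)
    (a b : ℝ) {τ : ℝ} (hτ : 0 ≤ τ) :
    HasDerivWithinAt (fun s ↦ ∫ x in a..b, f (x, s)) (∫ x in a..b, f' (x, τ)) (Ici 0) τ := by
  let G : ℝ → ℝ → ℝ := fun r x ↦ f' (x, max r 0)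
  have hG : Continuous G.uncurry :=
    hf'.comp_continuous (by fun_prop) fun p ↦ mk_mem_closedHalfPlane _ (le_max_right _ _)
  have hI : Continuous fun r ↦ ∫ x in a..b, G r x :=
    intervalIntegral.continuous_parametric_intervalIntegral_of_continuous' hG a b
  have hrepr : ∀ s ∈ Ici (0 : ℝ), ∫ x in a..b, f (x, s) =
      (∫ x in a..b, f (x, 0)) + ∫ r in (0 : ℝ)..s, ∫ x in a..b, G r x := by
    intro s hs
    have hswap : ∫ r in (0 : ℝ)..s, ∫ x in a..b, G r x =
        ∫ x in a..b, ∫ r in (0 : ℝ)..s, G r x :=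
      intervalIntegral_intervalIntegral_swap
        ((hG.continuousOn.integrableOn_compact (isCompact_uIcc.prod isCompact_uIcc)).mono_set
          (prod_mono uIoc_subset_uIcc uIoc_subset_uIcc))
    have hftc (x : ℝ) : ∫ r in (0 : ℝ)..s, G r x = f (x, s) - f (x, 0) := by
      refine intervalIntegral.integral_eq_sub_of_hasDerivAt_of_le (f := fun r ↦ f (x, r)) hs
        (fun r hr ↦ ((hderiv x r hr.1).continuousWithinAt).mono Icc_subset_Ici_self)
        (fun r hr ↦ ?_) (Continuous.intervalIntegrable ?_ _ _)
      · simpa [G, max_eq_left hr.1.le] using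
          (hderiv x r hr.1.le).hasDerivAt (Ici_mem_nhds hr.1)
      · exact hG.comp (by fun_prop : Continuous fun r : ℝ ↦ (r, x))
    rw [hswap]
    simp only [hftc]
    rw [intervalIntegral.integral_sub
      ((continuous_halfPlane_fst hf hs).intervalIntegrable _ _)
      ((continuous_halfPlane_fst hf le_rfl).intervalIntegrable _ _)]
    ring
  have hmain := ((hI.integral_hasStrictDerivAt 0 τ).hasDerivAt.const_add
    (∫ x in a..b, f (x, 0))).hasDerivWithinAt (s := Ici 0)
  simp only [G, max_eq_left hτ] at hmain
  exact hmain.congr hrepr (hrepr τ hτ)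

end HalfPlane

/-- Integrating by parts twice, with boundary terms that cancel. -/
lemma integral_mul_deriv_deriv_eq_of_boundary {a b : ℝ} {u u' u'' w w' w'' : ℝ → ℝ}
    (hu : ∀ x, HasDerivAt u (u' x) x) (hu' : ∀ x, HasDerivAt u' (u'' x) x)
    (hw : ∀ x, HasDerivAt w (w' x) x) (hw' : ∀ x, HasDerivAt w' (w'' x) x)
    (hu'' : Continuous u'') (hw'' : Continuous w'')
    (hbu : u b = u a) (hbu' : u' b = u' a) (hbw : w b = w a) (hbw' : w' b = w' a) :
    ∫ x in a..b, u x * w'' x = ∫ x in a..b, u'' x * w x := by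
  have cont {h h' : ℝ → ℝ} (H : ∀ x, HasDerivAt h (h' x) x) : Continuous h :=
    continuous_iff_continuousAt.2 fun x ↦ (H x).continuousAt
  rw [intervalIntegral.integral_mul_deriv_eq_deriv_mul (fun x _ ↦ hu x) (fun x _ ↦ hw' x)
      ((cont hu').intervalIntegrable _ _) (hw''.intervalIntegrable _ _),
    intervalIntegral.integral_mul_deriv_eq_deriv_mul (fun x _ ↦ hu' x) (fun x _ ↦ hw x)
      (hu''.intervalIntegrable _ _) ((cont hw').intervalIntegrable _ _),
    hbu, hbu', hbw, hbw']
  ring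


/-- The rescaled equation `v_τ = v²(−v_xxxx + v) − (1/2)v`, for a smooth positive
`2L`-periodic-in-`x` solution `v` on `ℝ × [0,∞)`, is a gradient system: the energy
`E(τ) = ∫₀^{2L} [(1/2)(v_xx)² − (1/2)v² + (1/2)ln v] dx` is differentiable with
`E′(τ) = −∫₀^{2L} (v_τ)²/v² dx ≤ 0`; in particular `E` is non-increasing on `[0,∞)`. -/
theorem rescaled_flow_is_gradient_system (L : ℝ) (hL : 0 < L)
    (v : ℝ → ℝ → ℝ)
    (hsmooth : ContDiffOn ℝ (⊤ : ℕ∞) (Function.uncurry v) (Set.univ ×ˢ Set.Ici (0:ℝ)))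
    (hper : ∀ x τ, 0 ≤ τ → v (x + 2*L) τ = v x τ)
    (hpos : ∀ x τ, 0 ≤ τ → 0 < v x τ)
    (heq : ∀ x τ, 0 ≤ τ →
      derivWithin (fun s => v x s) (Set.Ici (0:ℝ)) τ
        = (v x τ)^2 * (-(iteratedDeriv 4 (fun y => v y τ) x) + v x τ)
          - (1/2 : ℝ) * v x τ) :
    (∀ τ : ℝ, 0 ≤ τ →
      HasDerivWithinAt (rescaledEnergy L v)
        (-∫ x in (0:ℝ)..(2*L),
          (derivWithin (fun s => v x s) (Set.Ici (0:ℝ)) τ)^2 / (v x τ)^2)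
        (Set.Ici (0:ℝ)) τ ∧
      (-∫ x in (0:ℝ)..(2*L),
          (derivWithin (fun s => v x s) (Set.Ici (0:ℝ)) τ)^2 / (v x τ)^2) ≤ 0) ∧
    AntitoneOn (rescaledEnergy L v) (Set.Ici 0) := by
  set w : ℝ × ℝ → ℝ := Function.uncurry v
  set X : (ℝ × ℝ → ℝ) → ℝ × ℝ → ℝ := halfPlaneDeriv (1, 0)
  set p : ℝ × ℝ → ℝ := halfPlaneDeriv (0, 1) w with hp_def
  have hw : ContDiffOn ℝ (⊤ : ℕ∞) w closedHalfPlane := hsmooth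
  have hp : ContDiffOn ℝ (⊤ : ℕ∞) p closedHalfPlane := hw.halfPlaneDeriv _
  have hXw : ContDiffOn ℝ (⊤ : ℕ∞) (X w) closedHalfPlane := hw.halfPlaneDeriv _
  have hXXw : ContDiffOn ℝ (⊤ : ℕ∞) (X (X w)) closedHalfPlane := hXw.halfPlaneDeriv _
  have hXXXw : ContDiffOn ℝ (⊤ : ℕ∞) (X (X (X w))) closedHalfPlane := hXXw.halfPlaneDeriv _
  have hXXXXw : ContDiffOn ℝ (⊤ : ℕ∞) (X (X (X (X w)))) closedHalfPlane := hXXXw.halfPlaneDeriv _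
  have hXp : ContDiffOn ℝ (⊤ : ℕ∞) (X p) closedHalfPlane := hp.halfPlaneDeriv _
  have hXXp : ContDiffOn ℝ (⊤ : ℕ∞) (X (X p)) closedHalfPlane := hXp.halfPlaneDeriv _
  have hwper : ∀ x τ, 0 ≤ τ → w (x + 2 * L, τ) = w (x, τ) := hper
  have hcomm : EqOn (halfPlaneDeriv (0, 1) (X (X w))) (X (X p)) closedHalfPlane :=
    (halfPlaneDeriv_comm hXw _ _).trans
      (halfPlaneDeriv_congr (halfPlaneDeriv_comm hw _ _) _)
  have hvτ (x τ : ℝ) (hτ : 0 ≤ τ) : derivWithin (fun s => v x s) (Ici 0) τ = p (x, τ) :=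
    (hasDerivWithinAt_halfPlane_snd hw x hτ).derivWithin (uniqueDiffOn_Ici 0 τ hτ)
  have hflow (x τ : ℝ) (hτ : 0 ≤ τ) : p (x, τ) =
      w (x, τ) ^ 2 * (-X (X (X (X w))) (x, τ) + w (x, τ)) - 1 / 2 * w (x, τ) := by
    rw [← hvτ x τ hτ, heq x τ hτ]
    have := congrFun (iteratedDeriv_halfPlane_fst hw hτ 4) x
    simp only [Function.iterate_succ_apply, Function.iterate_zero_apply] at this
    change iteratedDeriv 4 (fun y ↦ v y τ) x = _ at this
    rw [this]
    rfl
  let F : ℝ × ℝ → ℝ := fun q ↦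
    1 / 2 * (X (X w) q) ^ 2 - 1 / 2 * (w q) ^ 2 + 1 / 2 * Real.log (w q)
  let F' : ℝ × ℝ → ℝ := fun q ↦ X (X w) q * X (X p) q - w q * p q + 1 / 2 * (p q / w q)
  have hE : ∀ τ ∈ Ici (0 : ℝ), rescaledEnergy L v τ = ∫ x in (0 : ℝ)..(2 * L), F (x, τ) := by
    intro τ hτ
    have := iteratedDeriv_halfPlane_fst hw hτ 2
    simp only [Function.iterate_succ_apply, Function.iterate_zero_apply] at this
    change iteratedDeriv 2 (fun y ↦ v y τ) = _ at this
    rw [rescaledEnergy, this]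
    rfl
  have hwne : ∀ q ∈ closedHalfPlane, w q ≠ 0 := fun q hq ↦ (hpos q.1 q.2 hq.2).ne'
  have hF : ContinuousOn F closedHalfPlane :=
    (((hXXw.continuousOn.pow 2).const_mul _).sub ((hw.continuousOn.pow 2).const_mul _)).add
      ((hw.continuousOn.log hwne).const_mul _)
  have hF' : ContinuousOn F' closedHalfPlane :=
    ((hXXw.continuousOn.mul hXXp.continuousOn).sub (hw.continuousOn.mul hp.continuousOn)).add
      ((hp.continuousOn.div hw.continuousOn hwne).const_mul _)
  have hFderiv (x τ : ℝ) (hτ : 0 ≤ τ) :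
      HasDerivWithinAt (fun s ↦ F (x, s)) (F' (x, τ)) (Ici 0) τ := by
    have h1 := hasDerivWithinAt_halfPlane_snd hXXw x hτ
    rw [hcomm (mk_mem_closedHalfPlane x hτ)] at h1
    have h2 := hasDerivWithinAt_halfPlane_snd hw x hτ
    have h3 := h2.log (hwne _ (mk_mem_closedHalfPlane x hτ))
    refine ((((h1.fun_pow 2).const_mul (1 / 2)).sub ((h2.fun_pow 2).const_mul (1 / 2))).add
      (h3.const_mul (1 / 2))).congr_deriv ?_
    simp only [F', ← hp_def]
    ring
  have hdiss (τ : ℝ) (hτ : 0 ≤ τ) : ∫ x in (0 : ℝ)..(2 * L), F' (x, τ) =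
      -∫ x in (0 : ℝ)..(2 * L),
        (derivWithin (fun s => v x s) (Ici (0 : ℝ)) τ) ^ 2 / (v x τ) ^ 2 := by
    have c {f : ℝ × ℝ → ℝ} (hf : ContDiffOn ℝ (⊤ : ℕ∞) f closedHalfPlane) :
        Continuous fun x ↦ f (x, τ) := continuous_halfPlane_fst hf.continuousOn hτ
    have hperX {f : ℝ × ℝ → ℝ} (hf : ContDiffOn ℝ (⊤ : ℕ∞) f closedHalfPlane)
        (h : ∀ x τ, 0 ≤ τ → f (x + 2 * L, τ) = f (x, τ)) :=
      halfPlaneDeriv_periodic hf h (1, 0)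
    have hbdry {f : ℝ × ℝ → ℝ} (h : ∀ x τ, 0 ≤ τ → f (x + 2 * L, τ) = f (x, τ)) :
        f (2 * L, τ) = f (0, τ) := by simpa using h 0 τ hτ
    have hperXX := hperX hXw (hperX hw hwper)
    have hperp := halfPlaneDeriv_periodic hw hwper (0, 1)
    have hparts : ∫ x in (0 : ℝ)..(2 * L), X (X w) (x, τ) * X (X p) (x, τ) =
        ∫ x in (0 : ℝ)..(2 * L), X (X (X (X w))) (x, τ) * p (x, τ) :=
      integral_mul_deriv_deriv_eq_of_boundary
        (fun x ↦ hasDerivAt_halfPlane_fst hXXw x hτ) (fun x ↦ hasDerivAt_halfPlane_fst hXXXw x hτ)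
        (fun x ↦ hasDerivAt_halfPlane_fst hp x hτ) (fun x ↦ hasDerivAt_halfPlane_fst hXp x hτ)
        (c hXXXXw) (c hXXp) (hbdry hperXX) (hbdry (hperX hXXw hperXX)) (hbdry hperp)
        (hbdry (hperX hp hperp))
    have hrest : Continuous fun x ↦ F' (x, τ) - X (X w) (x, τ) * X (X p) (x, τ) :=
      (continuous_halfPlane_fst hF' hτ).sub ((c hXXw).mul (c hXXp))
    have hprod : Continuous fun x ↦ X (X w) (x, τ) * X (X p) (x, τ) := (c hXXw).mul (c hXXp)
    have hprod' : Continuous fun x ↦ X (X (X (X w))) (x, τ) * p (x, τ) := (c hXXXXw).mul (c hp)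
    calc ∫ x in (0 : ℝ)..(2 * L), F' (x, τ)
        = ∫ x in (0 : ℝ)..(2 * L), (X (X w) (x, τ) * X (X p) (x, τ) +
            (F' (x, τ) - X (X w) (x, τ) * X (X p) (x, τ))) := by simp
      _ = ∫ x in (0 : ℝ)..(2 * L), (X (X (X (X w))) (x, τ) * p (x, τ) +
            (F' (x, τ) - X (X w) (x, τ) * X (X p) (x, τ))) := by
          rw [intervalIntegral.integral_add (hprod.intervalIntegrable _ _)
            (hrest.intervalIntegrable _ _), hparts, ← intervalIntegral.integral_add
            (hprod'.intervalIntegrable _ _) (hrest.intervalIntegrable _ _)]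
      _ = _ := by
          rw [← intervalIntegral.integral_neg]
          refine intervalIntegral.integral_congr fun x _ ↦ ?_
          have hne : w (x, τ) ≠ 0 := hwne _ (mk_mem_closedHalfPlane x hτ)
          have hpx := hflow x τ hτ
          change _ = -(derivWithin (fun s => v x s) (Ici (0 : ℝ)) τ ^ 2 / w (x, τ) ^ 2)
          simp only [F', hvτ x τ hτ]
          field_simp
          linear_combination 2 * p (x, τ) * hpx
  have hderivE (τ : ℝ) (hτ : 0 ≤ τ) : HasDerivWithinAt (rescaledEnergy L v)
      (-∫ x in (0 : ℝ)..(2 * L),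
        (derivWithin (fun s => v x s) (Ici (0 : ℝ)) τ) ^ 2 / (v x τ) ^ 2) (Ici 0) τ := by
    rw [← hdiss τ hτ]
    exact (hasDerivWithinAt_integral_halfPlane hF hF' hFderiv 0 (2 * L) hτ).congr hE (hE τ hτ)
  have hnonpos (τ : ℝ) : -∫ x in (0 : ℝ)..(2 * L),
      (derivWithin (fun s => v x s) (Ici (0 : ℝ)) τ) ^ 2 / (v x τ) ^ 2 ≤ 0 :=
    neg_nonpos.2 (intervalIntegral.integral_nonneg (by positivity) fun x _ ↦ by positivity)
  refine ⟨fun τ hτ ↦ ⟨hderivE τ hτ, hnonpos τ⟩, ?_⟩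
  exact antitoneOn_of_hasDerivWithinAt_nonpos (convex_Ici 0)
    (fun τ hτ ↦ (hderivE τ hτ).continuousWithinAt)
    (fun τ hτ ↦ (hderivE τ (interior_subset hτ)).mono interior_subset) fun τ _ ↦ hnonpos τ
end

section
/- Define g(y) = 2^{−1/2}·y²·(ln(−y))^{1/2} for y < −e. Then for every λ ∈ ℝ, the quantity [ (1/2)·g(y) − λ·g′(y) + g(y)²·g⁗(y) ] / g(y) tends to 0 as y → −∞. Equivalently, g satisfies the log-TW equation (1/2)g − λg′ = −g²g⁗ up to an error that is o(g(y)) as y → −∞. -/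
open Set in
/-- On an open set, the derivative of `f` agrees with the pointwise derivative of any function
that agrees with `f` there. -/
lemma eqOn_deriv_of_eqOn_of_hasDerivAt {f F F' : ℝ → ℝ} {s : Set ℝ} (hs : IsOpen s)
    (hf : EqOn f F s) (hF : ∀ y ∈ s, HasDerivAt F (F' y) y) : EqOn (deriv f) F' s := fun y hy =>
  ((hF y hy).congr_of_eventuallyEq (hf.eventuallyEq_of_mem (hs.mem_nhds hy))).deriv

/-- The square root of `log (-y)` is positive for `y < -e`. -/
lemma sqrt_log_neg_pos {y : ℝ} (hy : y < -Real.exp 1) : 0 < √(Real.log (-y)) := by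
  have h1 : 1 < Real.exp 1 := Real.one_lt_exp_iff.2 one_pos
  exact Real.sqrt_pos.2 (Real.log_pos (by linarith))

lemma hasDerivAt_sqrt_log_neg {y : ℝ} (hy : y < -Real.exp 1) :
    HasDerivAt (fun x => √(Real.log (-x))) (1 / (2 * y * √(Real.log (-y)))) y := by
  have h0 : y ≠ 0 := by linarith [Real.exp_pos 1]
  have hS := sqrt_log_neg_pos hy
  have hL : Real.log (-y) ≠ 0 := (Real.sqrt_pos.1 hS).ne'
  convert ((hasDerivAt_neg y).log (neg_ne_zero.2 h0)).sqrt hL using 1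
  field_simp

/-- The profile `g(y) = 2^{−1/2}·y²·(ln(−y))^{1/2}` (for `y < −e`) satisfies the
log-travelling-wave equation `(1/2)g − λg′ = −g²g⁗` up to an error that is
`o(g(y))` as `y → −∞`, for every `λ ∈ ℝ`. -/
theorem log_tw_asymptotics_fourth_order (g : ℝ → ℝ)
    (hg : ∀ y : ℝ, y < -Real.exp 1 →
      g y = (2:ℝ) ^ (-(1/2) : ℝ) * y^2 * Real.log (-y) ^ ((1:ℝ)/2)) :
    ∀ lam : ℝ,
      Filter.Tendsto
        (fun y => ((1/2 : ℝ) * g y - lam * deriv g y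
          + (g y)^2 * iteratedDeriv 4 g y) / g y)
        Filter.atBot (nhds 0) := by
  intro lam
  obtain ⟨c, hc⟩ : ∃ c : ℝ, c = (2:ℝ) ^ (-(1/2) : ℝ) := ⟨_, rfl⟩
  have hc0 : c ≠ 0 := by rw [hc]; positivity
  have hc2 : c ^ 2 = 1 / 2 := by
    rw [hc, ← Real.rpow_natCast, ← Real.rpow_mul (by norm_num)]
    norm_num [Real.rpow_neg_one]
  obtain ⟨S, hS⟩ : ∃ S : ℝ → ℝ, S = fun x => √(Real.log (-x)) := ⟨_, rfl⟩
  have hy0 : ∀ y ∈ Set.Iio (-Real.exp 1), y ≠ 0 := fun y hy => by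
    have : y < -Real.exp 1 := hy
    linarith [Real.exp_pos 1]
  have hS0 : ∀ y ∈ Set.Iio (-Real.exp 1), S y ≠ 0 := fun y hy => by
    rw [hS]; exact (sqrt_log_neg_pos hy).ne'
  have hSd : ∀ y ∈ Set.Iio (-Real.exp 1), HasDerivAt S (1 / (2 * y * S y)) y := fun y hy => by
    rw [hS]; exact hasDerivAt_sqrt_log_neg hy
  have g0 : Set.EqOn g (fun y => c * (y ^ 2 * S y)) (Set.Iio (-Real.exp 1)) := fun y hy => by
    rw [hg y hy, hc, hS, ← Real.sqrt_eq_rpow, mul_assoc]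
  have g1 : Set.EqOn (deriv g) (fun y => c * (y * (2 * S y + 1 / 2 * (S y)⁻¹)))
      (Set.Iio (-Real.exp 1)) := by
    refine eqOn_deriv_of_eqOn_of_hasDerivAt isOpen_Iio g0 fun y hy => ?_
    have h0 := hy0 y hy
    have h1 := hS0 y hy
    refine ((((hasDerivAt_id' y).fun_pow 2).fun_mul (hSd y hy)).const_mul c).congr_deriv ?_
    simp only [Nat.reduceSub, Nat.cast_ofNat, pow_one]
    field_simp
  have g2 : Set.EqOn (deriv (deriv g))
      (fun y => c * (2 * S y + 3 / 2 * (S y)⁻¹ - 1 / 4 * ((S y)⁻¹) ^ 3))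
      (Set.Iio (-Real.exp 1)) := by
    refine eqOn_deriv_of_eqOn_of_hasDerivAt isOpen_Iio g1 fun y hy => ?_
    have h0 := hy0 y hy
    have h1 := hS0 y hy
    have hd := hSd y hy
    refine (((hasDerivAt_id' y).fun_mul
      ((hd.const_mul 2).fun_add ((hd.fun_inv h1).const_mul (1 / 2)))).const_mul c).congr_deriv ?_
    field_simp
    ring
  have g3 : Set.EqOn (deriv (deriv (deriv g)))
      (fun y => c * (y⁻¹ * ((S y)⁻¹ - 3 / 4 * ((S y)⁻¹) ^ 3 + 3 / 8 * ((S y)⁻¹) ^ 5)))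
      (Set.Iio (-Real.exp 1)) := by
    refine eqOn_deriv_of_eqOn_of_hasDerivAt isOpen_Iio g2 fun y hy => ?_
    have h0 := hy0 y hy
    have h1 := hS0 y hy
    have hd := hSd y hy
    have hi := hd.fun_inv h1
    refine ((((hd.const_mul 2).fun_add (hi.const_mul (3 / 2))).fun_sub
      ((hi.fun_pow 3).const_mul (1 / 4))).const_mul c).congr_deriv ?_
    simp only [Nat.reduceSub, Nat.cast_ofNat]
    field_simp
    ring
  have g4 : Set.EqOn (deriv (deriv (deriv (deriv g))))
      (fun y => c * ((y⁻¹) ^ 2 * (-(S y)⁻¹ + 1 / 4 * ((S y)⁻¹) ^ 3 + 3 / 4 * ((S y)⁻¹) ^ 5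
        - 15 / 16 * ((S y)⁻¹) ^ 7)))
      (Set.Iio (-Real.exp 1)) := by
    refine eqOn_deriv_of_eqOn_of_hasDerivAt isOpen_Iio g3 fun y hy => ?_
    have h0 := hy0 y hy
    have h1 := hS0 y hy
    have hi := (hSd y hy).fun_inv h1
    refine (((hasDerivAt_inv h0).fun_mul ((hi.fun_sub ((hi.fun_pow 3).const_mul (3 / 4))).fun_add
      ((hi.fun_pow 5).const_mul (3 / 8)))).const_mul c).congr_deriv ?_
    simp only [Nat.reduceSub, Nat.cast_ofNat]
    field_simp
    ring
  have hSinv : Filter.Tendsto (fun y => (S y)⁻¹) Filter.atBot (nhds 0) := by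
    rw [hS]
    exact (Real.tendsto_sqrt_atTop.comp
      (Real.tendsto_log_atTop.comp Filter.tendsto_neg_atBot_atTop)).inv_tendsto_atTop
  have hyinv : Filter.Tendsto (fun y : ℝ => y⁻¹) Filter.atBot (nhds 0) := tendsto_inv_atBot_zero
  have hcont : Continuous fun p : ℝ × ℝ => -lam * (p.1 * (2 + 1 / 2 * p.2 ^ 2))
      + 1 / 2 * (1 / 4 * p.2 ^ 2 + 3 / 4 * p.2 ^ 4 - 15 / 16 * p.2 ^ 6) := by fun_prop
  have hlim := (hcont.tendsto (0, 0)).comp (hyinv.prodMk_nhds hSinv)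
  norm_num at hlim
  refine hlim.congr' ?_
  filter_upwards [Filter.Iio_mem_atBot (-Real.exp 1)] with y hy
  have h0 := hy0 y hy
  have h1 := hS0 y hy
  have h4 : iteratedDeriv 4 g y = deriv (deriv (deriv (deriv g))) y := by
    simp only [iteratedDeriv_succ, iteratedDeriv_zero]
  rw [h4, g4 hy, g1 hy, g0 hy]
  simp only [Function.comp]
  field_simp
  rw [hc2]
  ring
end

section
/- Let I ⊆ ℝ be an open interval and let θ ∈ C⁶(I) satisfy θ(x) > 0 and (1/2)·θ(x) = θ(x)²·(θ⁽⁶⁾(x) + θ(x)) for all x ∈ I, where θ⁽⁶⁾ denotes the sixth derivative. Then the function x ↦ (1/2)·ln θ(x) − θ⁽⁵⁾(x)·θ′(x) + θ⁗(x)·θ″(x) − (1/2)·(θ‴(x))² − (1/2)·θ(x)² is constant on I. -/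
/-- On an open set, the `m`-th derivative of a `C^n` function with `m < n` has the `(m+1)`-th
derivative as its derivative. -/
theorem ContDiffOn.hasDerivAt_iteratedDerivWithin_of_isOpen {s : Set ℝ} {f : ℝ → ℝ} {n : WithTop ℕ∞}
    {m : ℕ} (hf : ContDiffOn ℝ n f s) (hs : IsOpen s) (hmn : m < n) {x : ℝ} (hx : x ∈ s) :
    HasDerivAt (iteratedDerivWithin m f s) (iteratedDerivWithin (m + 1) f s x) x := by
  rw [iteratedDerivWithin_succ]
  exact ((hf.differentiableOn_iteratedDerivWithin hmn hs.uniqueDiffOn) x hx).hasDerivWithinAt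
    |>.hasDerivAt (hs.mem_nhds hx)

/-- First-integral identity for the sixth-order blow-up profile ODE
`(1/2)θ = θ²(θ⁽⁶⁾ + θ)`: on any open interval `I` where `θ ∈ C⁶` is positive and
satisfies the ODE, the quantity
`(1/2)ln θ − θ⁽⁵⁾θ′ + θ⁗θ″ − (1/2)(θ‴)² − (1/2)θ²` is constant. -/
theorem sixth_order_profile_first_integral
    (I : Set ℝ) (hIopen : IsOpen I) (hIconn : I.OrdConnected)
    (θ : ℝ → ℝ) (hθ : ContDiffOn ℝ 6 θ I)
    (hpos : ∀ x ∈ I, 0 < θ x)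
    (hode : ∀ x ∈ I,
      (1/2 : ℝ) * θ x = (θ x)^2 * (iteratedDerivWithin 6 θ I x + θ x)) :
    ∃ c : ℝ, ∀ x ∈ I,
      (1/2 : ℝ) * Real.log (θ x)
        - iteratedDerivWithin 5 θ I x * derivWithin θ I x
        + iteratedDerivWithin 4 θ I x * iteratedDerivWithin 2 θ I x
        - (1/2 : ℝ) * (iteratedDerivWithin 3 θ I x)^2
        - (1/2 : ℝ) * (θ x)^2 = c := by
  have hderiv : ∀ m : ℕ, m < 6 → ∀ x ∈ I,
      HasDerivAt (iteratedDerivWithin m θ I) (iteratedDerivWithin (m + 1) θ I x) x :=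
    fun m hm x hx ↦ hθ.hasDerivAt_iteratedDerivWithin_of_isOpen hIopen (mod_cast hm) hx
  have hconst : ∀ x ∈ I, HasDerivAt (fun x ↦ (1/2 : ℝ) * Real.log (θ x)
        - iteratedDerivWithin 5 θ I x * derivWithin θ I x
        + iteratedDerivWithin 4 θ I x * iteratedDerivWithin 2 θ I x
        - (1/2 : ℝ) * (iteratedDerivWithin 3 θ I x)^2
        - (1/2 : ℝ) * (θ x)^2) 0 x := by
    intro x hx
    have hθ0 : θ x ≠ 0 := (hpos x hx).ne'
    have h0 := hderiv 0 (by norm_num) x hx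
    have h1 := hderiv 1 (by norm_num) x hx
    rw [iteratedDerivWithin_zero, zero_add, iteratedDerivWithin_one] at h0
    rw [iteratedDerivWithin_one] at h1
    have hsum := (((((h0.log hθ0).const_mul (1/2 : ℝ)).sub
      ((hderiv 5 (by norm_num) x hx).mul h1)).add
      ((hderiv 4 (by norm_num) x hx).mul (hderiv 2 (by norm_num) x hx))).sub
      (((hderiv 3 (by norm_num) x hx).pow 2).const_mul (1/2 : ℝ))).sub
      ((h0.pow 2).const_mul (1/2 : ℝ))
    refine hsum.congr_deriv ?_
    have hsixth : iteratedDerivWithin 6 θ I x = 1 / (2 * θ x) - θ x := by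
      field_simp
      apply mul_left_cancel₀ hθ0
      linear_combination -2 * hode x hx
    norm_num [hsixth]
    field_simp
    ring
  exact hIopen.exists_is_const_of_deriv_eq_zero hIconn.isPreconnected
    (fun x hx ↦ (hconst x hx).differentiableAt.differentiableWithinAt)
    (fun x hx ↦ (hconst x hx).deriv)
end

section
/- Define g(η) = (1/(2√3))·(−η)³·(ln(−η))^{1/2} for η < −e. Then the quantity [ (1/2)·g(η) − g(η)²·g⁽⁶⁾(η) ] / g(η) tends to 0 as η → −∞, where g⁽⁶⁾ denotes the sixth derivative. Equivalently, g satisfies the reduced log-TW equation (1/2)g = g²g⁽⁶⁾ up to an error that is o(g(η)) as η → −∞. -/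
open Polynomial in
/-- The function `η ↦ (-η)ⁿ √(log (-η)) q(1 / log (-η))`. -/
noncomputable def logProfile (n : ℤ) (q : ℝ[X]) (η : ℝ) : ℝ :=
  (-η) ^ n * Real.log (-η) ^ ((1 : ℝ) / 2) * q.eval (Real.log (-η))⁻¹

open Polynomial in
/-- The action of differentiation on the polynomial factor of `logProfile n q`. -/
noncomputable def logProfileStep (n : ℤ) (q : ℝ[X]) : ℝ[X] :=
  X ^ 2 * derivative q - C (n : ℝ) * q - C (1 / 2 : ℝ) * (X * q)

open Polynomial in
/-- The polynomial factor of the `k`-th derivative of `logProfile n q`. -/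
noncomputable def logProfileIter (n : ℤ) (q : ℝ[X]) : ℕ → ℝ[X]
  | 0 => q
  | k + 1 => logProfileStep (n - k) (logProfileIter n q k)

open Polynomial in
theorem hasDerivAt_logProfile (n : ℤ) (q : ℝ[X]) {η : ℝ} (hη : η < -1) :
    HasDerivAt (logProfile n q) (logProfile (n - 1) (logProfileStep n q) η) η := by
  have hy : 0 < -η := by linarith
  have hL : 0 < Real.log (-η) := Real.log_pos (by linarith)
  have hneg : HasDerivAt (fun x : ℝ => -x) (-1) η := hasDerivAt_neg η
  have hlog : HasDerivAt (fun x : ℝ => Real.log (-x)) (-1 / -η) η := hneg.log hy.ne'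
  have hpow : HasDerivAt (fun x : ℝ => (-x) ^ n) (n * (-η) ^ (n - 1) * -1) η :=
    (hasDerivAt_zpow n (-η) (Or.inl hy.ne')).comp η hneg
  have hroot := hlog.rpow_const (p := (1 : ℝ) / 2) (Or.inl hL.ne')
  have heval := (q.hasDerivAt (Real.log (-η))⁻¹).comp η (hlog.inv hL.ne')
  refine ((hpow.mul hroot).mul heval).congr_deriv ?_
  simp only [logProfile, logProfileStep, eval_sub, eval_mul, eval_pow, eval_X, eval_C,
    Function.comp, Pi.mul_apply, Pi.inv_apply]
  rw [Real.rpow_sub_one hL.ne', zpow_sub_one₀ hy.ne']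
  have hη0 : η ≠ 0 := by linarith
  field_simp
  ring

open Polynomial in
theorem iteratedDeriv_eqOn_logProfile {g : ℝ → ℝ} {n : ℤ} {q : ℝ[X]} {a : ℝ} (ha : a ≤ -1)
    (hg : Set.EqOn g (logProfile n q) (Set.Iio a)) (k : ℕ) :
    Set.EqOn (iteratedDeriv k g) (logProfile (n - k) (logProfileIter n q k)) (Set.Iio a) := by
  induction k with
  | zero => simpa [logProfileIter] using hg
  | succ k ih =>
    intro η hη
    rw [iteratedDeriv_succ, (ih.eventuallyEq_of_mem (Iio_mem_nhds hη)).deriv_eq,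
      (hasDerivAt_logProfile _ _ (lt_of_lt_of_le hη ha)).deriv, logProfileIter]
    push_cast
    rw [sub_sub]

open Polynomial in
theorem coeff_zero_logProfileStep (n : ℤ) (q : ℝ[X]) :
    (logProfileStep n q).coeff 0 = -n * q.coeff 0 := by
  simp [logProfileStep]

open Polynomial in
theorem coeff_one_logProfileStep (n : ℤ) (q : ℝ[X]) :
    (logProfileStep n q).coeff 1 = -n * q.coeff 1 - q.coeff 0 / 2 := by
  simp only [logProfileStep, coeff_sub, coeff_X_pow_mul', coeff_C_mul, coeff_X_mul]
  norm_num
  ring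

/-- The profile `g(η) = (1/(2√3))·(−η)³·(ln(−η))^{1/2}` (for `η < −e`) satisfies
the reduced log-travelling-wave equation `(1/2)g = g²g⁽⁶⁾` up to an error that is
`o(g(η))` as `η → −∞`. -/
theorem log_tw_asymptotics_sixth_order (g : ℝ → ℝ)
    (hg : ∀ η : ℝ, η < -Real.exp 1 →
      g η = (1 / (2 * Real.sqrt 3)) * (-η)^3 * Real.log (-η) ^ ((1:ℝ)/2)) :
    Filter.Tendsto
      (fun η => ((1/2 : ℝ) * g η - (g η)^2 * iteratedDeriv 6 g η) / g η)
      Filter.atBot (nhds 0) := by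
  set c : ℝ := 1 / (2 * Real.sqrt 3) with hc
  have hc0 : 0 < c := by positivity
  have hcc : c * c = 1 / 12 := by
    have h3 : Real.sqrt 3 * Real.sqrt 3 = 3 := Real.mul_self_sqrt (by norm_num)
    rw [hc, div_mul_div_comm, mul_mul_mul_comm, h3]
    norm_num
  have he : -Real.exp 1 ≤ -1 := neg_le_neg (Real.one_le_exp zero_le_one)
  have hprofile : Set.EqOn g (logProfile 3 (Polynomial.C c)) (Set.Iio (-Real.exp 1)) := by
    intro η hη
    rw [hg η hη, logProfile, Polynomial.eval_C, zpow_ofNat]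
    ring
  have hderiv := iteratedDeriv_eqOn_logProfile he hprofile 6
  set q := logProfileIter 3 (Polynomial.C c) 6 with hq
  have hq0 : q.coeff 0 = 0 := by
    simp [hq, logProfileIter, coeff_zero_logProfileStep]
  have hq1 : q.coeff 1 = 6 * c := by
    simp only [hq, logProfileIter, coeff_zero_logProfileStep, coeff_one_logProfileStep,
      Polynomial.coeff_C_zero, Polynomial.coeff_C_succ]
    push_cast
    ring
  have hinv : Filter.Tendsto (fun η : ℝ => (Real.log (-η))⁻¹) Filter.atBot (nhds 0) :=
    tendsto_inv_atTop_zero.comp (Real.tendsto_log_atTop.comp Filter.tendsto_neg_atBot_atTop)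
  have hlim := ((q.divX.continuous.tendsto 0).comp hinv).const_mul c |>.const_sub (1 / 2)
  have hzero : 1 / 2 - c * q.divX.eval 0 = 0 := by
    rw [← Polynomial.coeff_zero_eq_eval_zero, Polynomial.coeff_divX, zero_add, hq1]
    linarith
  rw [hzero] at hlim
  refine hlim.congr' ?_
  filter_upwards [Filter.Iio_mem_atBot (-Real.exp 1)] with η hη
  have hη1 : η < -1 := lt_of_lt_of_le hη he
  have hy : 0 < -η := by linarith
  have hL : 0 < Real.log (-η) := Real.log_pos (by linarith)
  have hroot : 0 < Real.log (-η) ^ ((1 : ℝ) / 2) := Real.rpow_pos_of_pos hL _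
  have hsq : Real.log (-η) ^ ((1 : ℝ) / 2) * Real.log (-η) ^ ((1 : ℝ) / 2) = Real.log (-η) := by
    rw [← Real.rpow_add hL]
    norm_num
  have hgpos : 0 < g η := by
    rw [hg η hη]
    positivity
  have hqeval : q.eval (Real.log (-η))⁻¹ =
      q.divX.eval (Real.log (-η))⁻¹ * (Real.log (-η))⁻¹ := by
    conv_lhs => rw [← Polynomial.divX_mul_X_add q, hq0]
    simp
  have hprod : g η * iteratedDeriv 6 g η = c * q.divX.eval (Real.log (-η))⁻¹ := by
    have hexp : (-η) ^ ((3 : ℤ) - (6 : ℕ)) = ((-η) ^ 3)⁻¹ := by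
      rw [show (3 : ℤ) - (6 : ℕ) = -(3 : ℕ) by norm_num, zpow_neg, zpow_natCast]
    have hcube : (-η) ^ 3 * ((-η) ^ 3)⁻¹ = 1 := mul_inv_cancel₀ (by positivity)
    have hloginv : Real.log (-η) * (Real.log (-η))⁻¹ = 1 := mul_inv_cancel₀ hL.ne'
    rw [hderiv hη, hg η hη, logProfile, hqeval, hexp]
    calc _ = c * q.divX.eval (Real.log (-η))⁻¹ * ((-η) ^ 3 * ((-η) ^ 3)⁻¹) *
          (Real.log (-η) ^ ((1 : ℝ) / 2) * Real.log (-η) ^ ((1 : ℝ) / 2) *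
            (Real.log (-η))⁻¹) := by ring
      _ = _ := by rw [hsq, hcube, hloginv, mul_one, mul_one]
  rw [eq_div_iff hgpos.ne', Function.comp_apply, ← hprod]
  ring
end

section
/- Define g(η) = (−η)·(ln(−η))^{1/3} for η < −e. Then the quantity [ (1/3)·g(η) − g(η)³·g‴(η) ] / g(η) tends to 0 as η → −∞. Equivalently, g satisfies the reduced log-TW equation (1/3)g = g³g‴ up to an error that is o(g(η)) as η → −∞. -/
open Set Filter Topology

/-- Functions that agree on an open set have the same derivative there. -/
lemma eqOn_deriv_of_eqOn {U : Set ℝ} (hU : IsOpen U) {f F F' : ℝ → ℝ} (hf : EqOn f F U)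
    (hF : ∀ x ∈ U, HasDerivAt F (F' x) x) : EqOn (deriv f) F' U := fun x hx =>
  ((hF x hx).congr_of_eventuallyEq (hf.eventuallyEq_of_mem (hU.mem_nhds hx))).deriv

lemma one_lt_log_of_lt_neg_exp {x : ℝ} (hx : x < -Real.exp 1) : 1 < Real.log x := by
  rw [← Real.log_neg_eq_log, Real.lt_log_iff_exp_lt (by linarith [Real.exp_pos 1])]
  linarith

lemma hasDerivAt_log_rpow {x : ℝ} (hx : x < -Real.exp 1) (a : ℝ) :
    HasDerivAt (fun y => Real.log y ^ a) (a * Real.log x ^ (a - 1) / x) x := by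
  have hx0 : x ≠ 0 := by linarith [Real.exp_pos 1]
  have hL : Real.log x ≠ 0 := by linarith [one_lt_log_of_lt_neg_exp hx]
  convert (Real.hasDerivAt_log hx0).rpow_const (p := a) (Or.inl hL) using 1
  field_simp

/-- The third derivative of `x ↦ -x (log (-x)) ^ a` on `(-∞, -e)`. -/
lemma iteratedDeriv_three_neg_mul_log_rpow {g : ℝ → ℝ} {a : ℝ}
    (hg : EqOn g (fun x => -x * Real.log x ^ a) (Iio (-Real.exp 1))) :
    EqOn (iteratedDeriv 3 g)
      (fun x => (a * Real.log x ^ (a - 1) -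
        a * (a - 1) * (a - 2) * Real.log x ^ (a - 3)) / x ^ 2) (Iio (-Real.exp 1)) := by
  have hne : ∀ x ∈ Iio (-Real.exp 1), x ≠ 0 := fun x hx => by
    have := mem_Iio.1 hx
    linarith [Real.exp_pos 1]
  have h₁ := eqOn_deriv_of_eqOn isOpen_Iio hg
    (F' := fun x => -(Real.log x ^ a + a * Real.log x ^ (a - 1))) fun x hx => by
      have := hne x hx
      refine ((hasDerivAt_neg x).mul (hasDerivAt_log_rpow hx a)).congr_deriv ?_
      field_simp
      ring
  have h₂ := eqOn_deriv_of_eqOn isOpen_Iio h₁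
    (F' := fun x => -(a * Real.log x ^ (a - 1) + a * (a - 1) * Real.log x ^ (a - 2)) / x)
    fun x hx => by
      have := hne x hx
      refine ((hasDerivAt_log_rpow hx a).add
        ((hasDerivAt_log_rpow hx (a - 1)).const_mul a)).neg.congr_deriv ?_
      rw [show a - 1 - 1 = a - 2 by ring]
      field_simp
  have h₃ := eqOn_deriv_of_eqOn isOpen_Iio h₂
    (F' := fun x => (a * Real.log x ^ (a - 1) -
        a * (a - 1) * (a - 2) * Real.log x ^ (a - 3)) / x ^ 2) fun x hx => by
      have := hne x hx
      refine ((((hasDerivAt_log_rpow hx (a - 1)).const_mul a).add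
        ((hasDerivAt_log_rpow hx (a - 2)).const_mul (a * (a - 1)))).neg.div
          (hasDerivAt_id x) this).congr_deriv ?_
      rw [show a - 1 - 1 = a - 2 by ring, show a - 2 - 1 = a - 3 by ring]
      simp only [id, Pi.add_apply, Pi.neg_apply]
      field_simp
      ring
  simpa only [iteratedDeriv_succ, iteratedDeriv_zero] using h₃

/-- The profile `g(η) = (−η)·(ln(−η))^{1/3}` (for `η < −e`) satisfies the reduced
log-travelling-wave equation `(1/3)g = g³g‴` up to an error that is `o(g(η))` as
`η → −∞`. -/
theorem log_tw_asymptotics_third_order (g : ℝ → ℝ)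
    (hg : ∀ η : ℝ, η < -Real.exp 1 →
      g η = (-η) * Real.log (-η) ^ ((1:ℝ)/3)) :
    Filter.Tendsto
      (fun η => ((1/3 : ℝ) * g η - (g η)^3 * iteratedDeriv 3 g η) / g η)
      Filter.atBot (nhds 0) := by
  have hg' : EqOn g (fun x => -x * Real.log x ^ ((1 : ℝ) / 3)) (Iio (-Real.exp 1)) :=
    fun x hx => by rw [hg x hx, Real.log_neg_eq_log]
  have hlog : Tendsto Real.log atBot atTop := by
    simpa [Function.comp_def] using Real.tendsto_log_atTop.comp tendsto_neg_atBot_atTop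
  have hlim : Tendsto (fun η => (10 / 27 : ℝ) * (Real.log η ^ 2)⁻¹) atBot (𝓝 0) := by
    simpa using (((tendsto_pow_atTop two_ne_zero).comp hlog).inv_tendsto_atTop).const_mul
      (10 / 27 : ℝ)
  refine hlim.congr' ?_
  filter_upwards [Iio_mem_atBot (-Real.exp 1)] with x hx
  have hx0 : x ≠ 0 := by
    have := mem_Iio.1 hx
    linarith [Real.exp_pos 1]
  have hL : 0 < Real.log x := by linarith [one_lt_log_of_lt_neg_exp hx]
  rw [iteratedDeriv_three_neg_mul_log_rpow hg' hx, hg' hx]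
  dsimp only
  rw [Real.rpow_sub hL, Real.rpow_sub hL, Real.rpow_one,
    show Real.log x ^ (3 : ℝ) = Real.log x ^ 3 by norm_cast]
  have hcube : (Real.log x ^ ((1 : ℝ) / 3)) ^ 3 = Real.log x := by
    rw [← Real.rpow_natCast, ← Real.rpow_mul hL.le]
    norm_num
  have hs : 0 < Real.log x ^ ((1 : ℝ) / 3) := Real.rpow_pos_of_pos hL _
  generalize Real.log x ^ ((1 : ℝ) / 3) = s at *
  rw [← hcube]
  field_simp
  ring
end
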